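/- In the even Clifford algebra A of the quadratic form diag(1,1,0) on ℂ³, set e₊ = (1/2)(1+x), e₋ = (1/2)(1−x), α = (1/2)(y+z), β = (1/2)(y−z). Then α² = 0, β² = 0, α·β = 0, β·α = 0, α·e₊ = α, e₋·α = α, α·e₋ = 0, e₊·α = 0, β·e₋ = β, e₊·β = β, β·e₊ = 0, e₋·β = 0, and moreover x = e₊ − e₋, y = α + β, z = α − β. (These are exactly the defining relations of the path algebra of the quiver with two vertices +, −, arrows α : + → −, β : − → +, and relations αβ = βα = 0.) -/

import Mathlib

open CliffordAlgebra

noncomputable section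

/-- The quadratic form `v ↦ v₀² + v₁²` on `ℂ³`, with Gram matrix `diag(1,1,0)` —
the quadratic form of a corank-1 degenerate conic. -/
def Q : QuadraticForm ℂ (Fin 3 → ℂ) := QuadraticMap.weightedSumSquares ℂ ![1, 1, 0]

/-- The standard basis vectors `e₁, e₂, e₃` of `ℂ³` (indexed by `0, 1, 2`). -/
def e (j : Fin 3) : Fin 3 → ℂ := Pi.single j 1

/-- `x = i·ι(e₁)·ι(e₂)` in the Clifford algebra of `Q`. -/
def x : CliffordAlgebra Q := Complex.I • (ι Q (e 0) * ι Q (e 1))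

/-- `y = i·ι(e₂)·ι(e₃)` in the Clifford algebra of `Q`. -/
def y : CliffordAlgebra Q := Complex.I • (ι Q (e 1) * ι Q (e 2))

/-- `z = ι(e₁)·ι(e₃)` in the Clifford algebra of `Q`. -/
def z : CliffordAlgebra Q := ι Q (e 0) * ι Q (e 2)

lemma x_mem : x ∈ even Q := Subalgebra.smul_mem _ (ι_mul_ι_mem_evenOdd_zero Q _ _) _

lemma y_mem : y ∈ even Q := Subalgebra.smul_mem _ (ι_mul_ι_mem_evenOdd_zero Q _ _) _

lemma z_mem : z ∈ even Q := ι_mul_ι_mem_evenOdd_zero Q _ _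

/-- `x` as an element of the even Clifford algebra `A = CliffordAlgebra.even Q`. -/
def xA : even Q := ⟨x, x_mem⟩

/-- `y` as an element of the even Clifford algebra `A = CliffordAlgebra.even Q`. -/
def yA : even Q := ⟨y, y_mem⟩

/-- `z` as an element of the even Clifford algebra `A = CliffordAlgebra.even Q`. -/
def zA : even Q := ⟨z, z_mem⟩

/-- `e₊ = (1/2)·(1 + x)` in the even Clifford algebra `A`. -/
def ePlus : even Q := (2 : ℂ)⁻¹ • (1 + xA)

/-- `e₋ = (1/2)·(1 − x)` in the even Clifford algebra `A`. -/
def eMinus : even Q := (2 : ℂ)⁻¹ • (1 - xA)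

/-- `α = (1/2)·(y + z)` in the even Clifford algebra `A`. -/
def alph : even Q := (2 : ℂ)⁻¹ • (yA + zA)

/-- `β = (1/2)·(y − z)` in the even Clifford algebra `A`. -/
def bet : even Q := (2 : ℂ)⁻¹ • (yA - zA)

lemma Q_apply (v : Fin 3 → ℂ) : Q v = v 0 * v 0 + v 1 * v 1 := by
  simp [Q, QuadraticMap.weightedSumSquares_apply, Fin.sum_univ_three]

lemma ι_e_zero_mul_self : ι Q (e 0) * ι Q (e 0) = 1 := by
  rw [ι_sq_scalar, Q_apply]; simp [e]

lemma ι_e_one_mul_self : ι Q (e 1) * ι Q (e 1) = 1 := by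
  rw [ι_sq_scalar, Q_apply]; simp [e]

lemma ι_e_two_mul_self : ι Q (e 2) * ι Q (e 2) = 0 := by
  rw [ι_sq_scalar, Q_apply]; simp [e]

/-- Distinct basis vectors anticommute in the Clifford algebra. -/
lemma ι_e_mul_ι_e_of_ne {j k : Fin 3} (h : j ≠ k) :
    ι Q (e j) * ι Q (e k) = -(ι Q (e k) * ι Q (e j)) := by
  apply ι_mul_ι_comm_of_isOrtho
  rw [QuadraticMap.isOrtho_def]
  simp only [Q_apply]
  fin_cases j <;> fin_cases k <;> simp [e] at h ⊢

section Anticommuting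

variable {R : Type*} [Ring R] {a b c : R}

lemma mul_mul_mul_eq_neg_of_anticomm (hba : b * a = -(a * b)) (d : R) :
    a * b * (a * d) = -(a * a * (b * d)) := by
  rw [mul_assoc, ← mul_assoc b, hba]; noncomm_ring

lemma mul_mul_mul_eq_of_mul_self (hb : b * b = 1) (d : R) : a * b * (b * d) = a * d := by
  rw [mul_assoc, ← mul_assoc b, hb, one_mul]

lemma mul_mul_mul_comm_of_anticomm (hca : c * a = -(a * c)) (hcb : c * b = -(b * c)) (d : R) :
    d * c * (a * b) = d * a * (b * c) := by
  rw [mul_assoc, ← mul_assoc c, hca, neg_mul, mul_assoc, hcb]; noncomm_ring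

lemma mul_mul_mul_eq_zero_of_anticomm (hca : c * a = -(a * c)) (hc : c * c = 0) (d : R) :
    d * c * (a * c) = 0 := by
  rw [mul_assoc, ← mul_assoc c, hca, neg_mul, mul_assoc, hc]; simp

end Anticommuting

lemma x_mul_y : x * y = -z := by
  simp only [x, y, z, smul_mul_smul_comm, Complex.I_mul_I,
    mul_mul_mul_eq_of_mul_self ι_e_one_mul_self, neg_smul, one_smul]

lemma x_mul_z : x * z = -y := by
  simp only [x, y, z, smul_mul_assoc, one_mul, smul_neg, ι_e_zero_mul_self,
    mul_mul_mul_eq_neg_of_anticomm (ι_e_mul_ι_e_of_ne (show (1 : Fin 3) ≠ 0 by decide))]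

lemma y_mul_x : y * x = z := by
  simp only [x, y, z, smul_mul_smul_comm, Complex.I_mul_I,
    mul_mul_mul_comm_of_anticomm (ι_e_mul_ι_e_of_ne (show (2 : Fin 3) ≠ 0 by decide))
      (ι_e_mul_ι_e_of_ne (show (2 : Fin 3) ≠ 1 by decide)),
    mul_mul_mul_eq_neg_of_anticomm (ι_e_mul_ι_e_of_ne (show (0 : Fin 3) ≠ 1 by decide)),
    ι_e_one_mul_self, one_mul, neg_smul, one_smul, neg_neg]

lemma z_mul_x : z * x = y := by
  simp only [x, y, z, mul_smul_comm, one_mul, ι_e_zero_mul_self,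
    mul_mul_mul_comm_of_anticomm (ι_e_mul_ι_e_of_ne (show (2 : Fin 3) ≠ 0 by decide))
      (ι_e_mul_ι_e_of_ne (show (2 : Fin 3) ≠ 1 by decide))]

lemma ι_e_mul_ι_e_two_mul {k : Fin 3} (hk : (2 : Fin 3) ≠ k) (j : Fin 3) :
    ι Q (e j) * ι Q (e 2) * (ι Q (e k) * ι Q (e 2)) = 0 :=
  mul_mul_mul_eq_zero_of_anticomm (ι_e_mul_ι_e_of_ne hk) ι_e_two_mul_self _

lemma y_mul_y : y * y = 0 := by
  simp [y, ι_e_mul_ι_e_two_mul (show (2 : Fin 3) ≠ 1 by decide)]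

lemma y_mul_z : y * z = 0 := by
  simp [y, z, ι_e_mul_ι_e_two_mul (show (2 : Fin 3) ≠ 0 by decide)]

lemma z_mul_y : z * y = 0 := by
  simp [y, z, ι_e_mul_ι_e_two_mul (show (2 : Fin 3) ≠ 1 by decide)]

lemma z_mul_z : z * z = 0 := by
  simp [z, ι_e_mul_ι_e_two_mul (show (2 : Fin 3) ≠ 0 by decide)]

set_option maxHeartbeats 1000000 in
/-- In the even Clifford algebra `A` of `diag(1,1,0)` on `ℂ³`, with
`e₊ = (1/2)(1+x)`, `e₋ = (1/2)(1−x)`, `α = (1/2)(y+z)`, `β = (1/2)(y−z)`, one has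
`α² = 0`, `β² = 0`, `α·β = 0`, `β·α = 0`, `α·e₊ = α`, `e₋·α = α`, `α·e₋ = 0`, `e₊·α = 0`,
`β·e₋ = β`, `e₊·β = β`, `β·e₊ = 0`, `e₋·β = 0`, and moreover `x = e₊ − e₋`, `y = α + β`,
`z = α − β`.  (These are exactly the defining relations of the path algebra of the quiver
with two vertices `+`, `−`, arrows `α : + → −`, `β : − → +` and relations `αβ = βα = 0`.) -/
theorem path_algebra_relations :
    alph * alph = 0 ∧ bet * bet = 0 ∧ alph * bet = 0 ∧ bet * alph = 0 ∧
    alph * ePlus = alph ∧ eMinus * alph = alph ∧ alph * eMinus = 0 ∧ ePlus * alph = 0 ∧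
    bet * eMinus = bet ∧ ePlus * bet = bet ∧ bet * ePlus = 0 ∧ eMinus * bet = 0 ∧
    xA = ePlus - eMinus ∧ yA = alph + bet ∧ zA = alph - bet := by
  have hxy : xA * yA = -zA := Subtype.ext x_mul_y
  have hxz : xA * zA = -yA := Subtype.ext x_mul_z
  have hyx : yA * xA = zA := Subtype.ext y_mul_x
  have hzx : zA * xA = yA := Subtype.ext z_mul_x
  have hyy : yA * yA = 0 := Subtype.ext y_mul_y
  have hyz : yA * zA = 0 := Subtype.ext y_mul_z
  have hzy : zA * yA = 0 := Subtype.ext z_mul_y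
  have hzz : zA * zA = 0 := Subtype.ext z_mul_z
  unfold alph bet ePlus eMinus
  refine ⟨?_, ?_, ?_, ?_, ?_, ?_, ?_, ?_, ?_, ?_, ?_, ?_, by module, by module, by module⟩ <;>
    simp only [smul_mul_smul_comm, mul_add, add_mul, mul_sub, sub_mul, mul_one, one_mul,
      hxy, hxz, hyx, hzx, hyy, hyz, hzy, hzz] <;>
    module
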